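/- arXiv:2211.08926 — 2 statements merged into one kernel-verified Lean document; each statement's English description precedes it below -/
import Mathlib

section
/- Let F be a field of characteristic 2 and A = (a_{ij}) a 3×3 matrix over F. Form the 2×2×2 cubic block R, a 12×12 matrix acting on the direct sum of three 4-dimensional thick spaces, as the ordered product of the 8 copies A^{(x)} for x ∈ {0,1}^3 respecting the coordinatewise partial order. Then each diagonal block R_{ii} (4×4, acting within the i-th thick space) equals a_{ii}^2 · 1_4. -/
open Matrix

/-- Index of the 12 lattice lines of the 2×2×2 cube: `(axis, the two
coordinates of the line in the remaining two directions)`. Each axis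
direction contributes the 4-dimensional thick space `F^4`. -/
abbrev Idx3 := Fin 3 × Fin 2 × Fin 2

/-- The line through the vertex `x ∈ {0,1}³` parallel to the `i`-th axis. -/
def line3 (x : Fin 2 × Fin 2 × Fin 2) (i : Fin 3) : Idx3 :=
  (i, if i = 0 then x.2.1 else x.1, if i = 2 then x.2.1 else x.2.2)

/-- The copy `A⁽ˣ⁾` of the 3×3 brick `A` at the vertex `x` of the unit cube:
it acts (on row vectors from the right) as `A` on the three lines through `x`
and as the identity on the other lines. -/
def cubeCopy {F : Type*} [Field F] (A : Matrix (Fin 3) (Fin 3) F)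
    (x : Fin 2 × Fin 2 × Fin 2) : Matrix Idx3 Idx3 F :=
  Matrix.of fun u v =>
    if u = line3 x u.1 ∧ v = line3 x v.1 then A u.1 v.1
    else if u = v then 1 else 0

/-- The 2×2×2 cubic block `R`: the product of the 8 copies `A⁽ˣ⁾`,
`x ∈ {0,1}³`, taken in an order compatible with the coordinatewise
partial order. -/
def cubeBlock {F : Type*} [Field F] (A : Matrix (Fin 3) (Fin 3) F) :
    Matrix Idx3 Idx3 F :=
  cubeCopy A (0, 0, 0) * cubeCopy A (1, 0, 0) * cubeCopy A (0, 1, 0) *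
  cubeCopy A (0, 0, 1) * cubeCopy A (1, 1, 0) * cubeCopy A (1, 0, 1) *
  cubeCopy A (0, 1, 1) * cubeCopy A (1, 1, 1)

/-- The 4×4 block `R_{ij}` of the cubic block, mapping the `i`-th thick
space to the `j`-th thick space. -/
def cubeBlk {F : Type*} [Field F] (A : Matrix (Fin 3) (Fin 3) F) (i j : Fin 3) :
    Matrix (Fin 2 × Fin 2) (Fin 2 × Fin 2) F :=
  Matrix.of fun u v => cubeBlock A (i, u) (j, v)

theorem cubeCopy_apply {F : Type*} [Field F] (A : Matrix (Fin 3) (Fin 3) F)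
    (x : Fin 2 × Fin 2 × Fin 2) (u v : Idx3) :
    cubeCopy A x u v =
      if u = line3 x u.1 ∧ v = line3 x v.1 then A u.1 v.1 else if u = v then 1 else 0 :=
  rfl

theorem mul_cubeCopy_apply {F : Type*} [Field F] (A : Matrix (Fin 3) (Fin 3) F)
    (M : Matrix Idx3 Idx3 F) (x : Fin 2 × Fin 2 × Fin 2) (u v : Idx3) :
    (M * cubeCopy A x) u v =
      if v = line3 x v.1 then
        M u (line3 x 0) * A 0 v.1 + M u (line3 x 1) * A 1 v.1 + M u (line3 x 2) * A 2 v.1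
      else M u v := by
  rw [Matrix.mul_apply]
  split_ifs with h
  · have hterm : ∀ w : Idx3, M u w * cubeCopy A x w v =
        if w.2 = (line3 x w.1).2 then M u (line3 x w.1) * A w.1 v.1 else 0 := by
      rintro ⟨i, p⟩
      by_cases hp : p = (line3 x i).2
      · subst hp
        have hl : (i, (line3 x i).2) = line3 x i := rfl
        have hi : (line3 x i).1 = i := rfl
        simp [cubeCopy, hl, hi, ← h]
      · have h1 : (i, p) ≠ line3 x i := fun e => hp (congrArg Prod.snd e)
        have h2 : (i, p) ≠ v := by
          rintro rfl
          exact h1 h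
        simp [cubeCopy, hp, h1, h2]
    simp only [hterm]
    rw [Fintype.sum_prod_type]
    simp [Fin.sum_univ_three]
  · simp [cubeCopy, h]

theorem stmt_4 (F : Type*) [Field F] [CharP F 2] (A : Matrix (Fin 3) (Fin 3) F) :
    ∀ i : Fin 3, cubeBlk A i i
      = (A i i) ^ 2 • (1 : Matrix (Fin 2 × Fin 2) (Fin 2 × Fin 2) F) := by
  have two : (2 : F) = 0 := CharTwo.two_eq_zero
  have cases : ∀ p : Fin 2 × Fin 2, p = (0, 0) ∨ p = (0, 1) ∨ p = (1, 0) ∨ p = (1, 1) := by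
    decide
  intro i
  ext u v
  rw [cubeBlk, Matrix.of_apply, cubeBlock]
  rcases cases u with rfl | rfl | rfl | rfl <;>
  rcases cases v with rfl | rfl | rfl | rfl <;>
  fin_cases i <;>
  simp [mul_cubeCopy_apply, cubeCopy_apply, line3] <;>
  grind
end

section
/- Let F be a field of characteristic 2 and A = (a_{ij}) a 3×3 matrix over F satisfying a_{12}a_{23}a_{31} ≠ a_{13}a_{32}a_{21}. Let R be the 12×12 matrix given by the 2×2×2 cubic block of A. Then R is similar (via a block-diagonal change of basis, one invertible 4×4 matrix per thick space) to the direct sum of one copy of the transpose-Frobenius matrix [[a_{11}^2, a_{21}^2, a_{31}^2],[a_{12}^2, a_{22}^2, a_{32}^2],[a_{13}^2, a_{23}^2, a_{33}^2]] and three copies of the Frobenius matrix [[a_{11}^2, a_{12}^2, a_{13}^2],[a_{21}^2, a_{22}^2, a_{23}^2],[a_{31}^2, a_{32}^2, a_{33}^2]]. -/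
open Matrix

/-- A block-diagonal matrix respecting the direct sum of the three thick spaces. -/
def blockDiag3 {F : Type*} [Field F]
    (g : Fin 3 → Matrix (Fin 2 × Fin 2) (Fin 2 × Fin 2) F) :
    Matrix Idx3 Idx3 F :=
  Matrix.of fun u v => if u.1 = v.1 then g u.1 u.2 v.2 else 0

theorem cubeCopy_mulVec {F : Type*} [Field F] (A : Matrix (Fin 3) (Fin 3) F)
    (x : Fin 2 × Fin 2 × Fin 2) (v : Idx3 → F) :
    cubeCopy A x *ᵥ v = fun u =>
      if u = line3 x u.1 then ∑ k, A u.1 k * v (line3 x k) else v u := by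
  funext u
  split_ifs with hu
  · have hentry (w : Idx3) : cubeCopy A x u w * v w =
        if w = line3 x w.1 then A u.1 w.1 * v (line3 x w.1) else 0 := by
      by_cases hw : w = line3 x w.1
      · simp only [cubeCopy, of_apply]
        rw [if_pos ⟨hu, hw⟩, if_pos hw, ← hw]
      · have huw : u ≠ w := by rintro rfl; exact hw hu
        simp [cubeCopy, hw, huw]
    simp only [mulVec, dotProduct, hentry]
    rw [Fintype.sum_prod_type]
    refine Finset.sum_congr rfl fun k _ => ?_
    rw [Fintype.sum_eq_single (line3 x k).2]
    · simp [line3]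
    · intro q hq
      exact if_neg fun hkq => hq (congrArg Prod.snd hkq)
  · simp [mulVec, dotProduct, cubeCopy, hu]

theorem cubeBlock_mulVec {F : Type*} [Field F] (A : Matrix (Fin 3) (Fin 3) F) (v : Idx3 → F) :
    cubeBlock A *ᵥ v =
      cubeCopy A (0, 0, 0) *ᵥ (cubeCopy A (1, 0, 0) *ᵥ (cubeCopy A (0, 1, 0) *ᵥ
      (cubeCopy A (0, 0, 1) *ᵥ (cubeCopy A (1, 1, 0) *ᵥ (cubeCopy A (1, 0, 1) *ᵥ
      (cubeCopy A (0, 1, 1) *ᵥ (cubeCopy A (1, 1, 1) *ᵥ v))))))) := by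
  simp only [cubeBlock, mulVec_mulVec, Matrix.mul_assoc]

/-- The vector of `F^12` whose component in the `i`-th thick space has the entries of `m i`. -/
def thickVec {F : Type*} (m : Fin 3 → Matrix (Fin 2) (Fin 2) F) : Idx3 → F :=
  fun u => m u.1 u.2.1 u.2.2

theorem cubeCopy_mulVec_thickVec {F : Type*} [Field F] (A : Matrix (Fin 3) (Fin 3) F)
    (p q r : Fin 2) (m : Fin 3 → Matrix (Fin 2) (Fin 2) F) :
    cubeCopy A (p, q, r) *ᵥ thickVec m = thickVec
      ![(m 0).updateRow q (Function.update (m 0 q) r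
          (A 0 0 * m 0 q r + A 0 1 * m 1 p r + A 0 2 * m 2 p q)),
        (m 1).updateRow p (Function.update (m 1 p) r
          (A 1 0 * m 0 q r + A 1 1 * m 1 p r + A 1 2 * m 2 p q)),
        (m 2).updateRow p (Function.update (m 2 p) q
          (A 2 0 * m 0 q r + A 2 1 * m 1 p r + A 2 2 * m 2 p q))] := by
  rw [cubeCopy_mulVec]
  funext ⟨i, j, k⟩
  fin_cases i <;>
    simp [line3, thickVec, Fin.sum_univ_three, updateRow_apply, Function.update_apply] <;>
    grind

theorem updateRow_update_zero_zero {F : Type*} (a b c d x : F) :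
    !![a, b; c, d].updateRow 0 (Function.update (!![a, b; c, d] 0) 0 x) = !![x, b; c, d] := by
  ext i j
  fin_cases i <;> fin_cases j <;> rfl

theorem updateRow_update_zero_one {F : Type*} (a b c d x : F) :
    !![a, b; c, d].updateRow 0 (Function.update (!![a, b; c, d] 0) 1 x) = !![a, x; c, d] := by
  ext i j
  fin_cases i <;> fin_cases j <;> rfl

theorem updateRow_update_one_zero {F : Type*} (a b c d x : F) :
    !![a, b; c, d].updateRow 1 (Function.update (!![a, b; c, d] 1) 0 x) = !![a, b; x, d] := by
  ext i j
  fin_cases i <;> fin_cases j <;> rfl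

theorem updateRow_update_one_one {F : Type*} (a b c d x : F) :
    !![a, b; c, d].updateRow 1 (Function.update (!![a, b; c, d] 1) 1 x) = !![a, b; c, x] := by
  ext i j
  fin_cases i <;> fin_cases j <;> rfl

/-- The vectors spanning the summands of the cubic block, indexed by summand: the first one
carries the transpose-Frobenius matrix, the other three the Frobenius matrix. -/
def summandVec {F : Type*} [Field F] (A : Matrix (Fin 3) (Fin 3) F) :
    Matrix (Fin 2) (Fin 2) (Fin 3 → Matrix (Fin 2) (Fin 2) F) :=
  !![![!![(A 0 1 * A 2 2 + A 0 2 * A 2 1) * (A 0 1 * A 1 2 + A 0 2 * A 1 1),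
            A 0 1 * (A 0 1 * A 1 2 + A 0 2 * A 1 1);
          A 0 2 * (A 0 1 * A 2 2 + A 0 2 * A 2 1), A 0 1 * A 0 2],
       !![(A 1 0 * A 2 2 + A 1 2 * A 2 0) * (A 0 0 * A 1 2 + A 0 2 * A 1 0),
            A 1 0 * (A 0 0 * A 1 2 + A 0 2 * A 1 0);
          A 1 2 * (A 1 0 * A 2 2 + A 1 2 * A 2 0), A 1 0 * A 1 2],
       !![(A 1 0 * A 2 1 + A 1 1 * A 2 0) * (A 0 0 * A 2 1 + A 0 1 * A 2 0),
            A 2 0 * (A 0 0 * A 2 1 + A 0 1 * A 2 0);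
          A 2 1 * (A 1 0 * A 2 1 + A 1 1 * A 2 0), A 2 0 * A 2 1]],
     ![!![A 1 1 * A 2 2 + A 1 2 * A 2 1, A 1 1; A 2 2, 1],
       !![A 0 1 * A 2 2 + A 0 2 * A 2 1, A 0 1; 0, 0],
       !![A 0 1 * A 1 2 + A 0 2 * A 1 1, A 0 2; 0, 0]];
     ![!![A 1 0 * A 2 2 + A 1 2 * A 2 0, A 1 0; 0, 0],
       !![A 0 0 * A 2 2 + A 0 2 * A 2 0, A 0 0; A 2 2, 1],
       !![A 0 0 * A 1 2 + A 0 2 * A 1 0, 0; A 1 2, 0]],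
     ![!![A 1 0 * A 2 1 + A 1 1 * A 2 0, 0; A 2 0, 0],
       !![A 0 0 * A 2 1 + A 0 1 * A 2 0, 0; A 2 1, 0],
       !![A 0 0 * A 1 1 + A 0 1 * A 1 0, A 0 0; A 1 1, 1]]]

/-- The matrix by which the cubic block acts on the summand `s`. -/
def summandMatrix {F : Type*} [Field F] (A : Matrix (Fin 3) (Fin 3) F) (s : Fin 2 × Fin 2) :
    Matrix (Fin 3) (Fin 3) F :=
  of fun i j => if s = (0, 0) then A j i ^ 2 else A i j ^ 2

set_option maxHeartbeats 4000000 in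
theorem cubeBlock_mulVec_summandVec {F : Type*} [Field F] [CharP F 2]
    (A : Matrix (Fin 3) (Fin 3) F) (s : Fin 2 × Fin 2) (c : Fin 3 → F) :
    cubeBlock A *ᵥ thickVec (fun i => c i • summandVec A s.1 s.2 i) =
      thickVec (fun i => (summandMatrix A s *ᵥ c) i • summandVec A s.1 s.2 i) := by
  have h2 : (2 : F) = 0 := CharTwo.two_eq_zero
  have hlit (m : Fin 3 → Matrix (Fin 2) (Fin 2) F) : (fun i => c i • m i) =
      ![!![c 0 * m 0 0 0, c 0 * m 0 0 1; c 0 * m 0 1 0, c 0 * m 0 1 1],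
        !![c 1 * m 1 0 0, c 1 * m 1 0 1; c 1 * m 1 1 0, c 1 * m 1 1 1],
        !![c 2 * m 2 0 0, c 2 * m 2 0 1; c 2 * m 2 1 0, c 2 * m 2 1 1]] := by
    funext i
    ext p q
    fin_cases i <;> fin_cases p <;> fin_cases q <;> rfl
  rw [cubeBlock_mulVec, hlit]
  simp only [cubeCopy_mulVec_thickVec, updateRow_update_zero_zero, updateRow_update_zero_one,
    updateRow_update_one_zero, updateRow_update_one_one, cons_val, of_apply]
  obtain ⟨s, t⟩ := s
  funext ⟨i, p, q⟩
  fin_cases s <;> fin_cases t <;> fin_cases i <;> fin_cases p <;> fin_cases q <;>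
    simp [thickVec, summandVec, summandMatrix, mulVec, dotProduct, Fin.sum_univ_three] <;>
    grind

theorem det_prod_fin_two {F : Type*} [Field F]
    (M : Matrix (Fin 2 × Fin 2) (Fin 2 × Fin 2) F) :
    M.det = det
      !![M (0, 0) (0, 0), M (0, 0) (0, 1), M (0, 0) (1, 0), M (0, 0) (1, 1);
        M (0, 1) (0, 0), M (0, 1) (0, 1), M (0, 1) (1, 0), M (0, 1) (1, 1);
        M (1, 0) (0, 0), M (1, 0) (0, 1), M (1, 0) (1, 0), M (1, 0) (1, 1);
        M (1, 1) (0, 0), M (1, 1) (0, 1), M (1, 1) (1, 0), M (1, 1) (1, 1)] := by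
  let e : Fin 2 × Fin 2 ≃ Fin 4 := finProdFinEquiv
  have hsymm : ⇑e.symm = ![(0, 0), (0, 1), (1, 0), (1, 1)] := by decide
  rw [← det_reindex_self e, reindex_apply, hsymm]
  congr 1
  ext i j
  fin_cases i <;> fin_cases j <;> rfl

theorem det_of_summandVec {F : Type*} [Field F] [CharP F 2] (A : Matrix (Fin 3) (Fin 3) F)
    (i : Fin 3) :
    (of fun p s : Fin 2 × Fin 2 => summandVec A s.1 s.2 i p.1 p.2).det =
      (A 0 1 * A 1 2 * A 2 0 - A 0 2 * A 2 1 * A 1 0) ^ 2 := by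
  have h2 : (2 : F) = 0 := CharTwo.two_eq_zero
  rw [det_prod_fin_two]
  fin_cases i <;>
    simp [det_succ_row_zero, Fin.sum_univ_succ, Fin.succAbove, summandVec] <;>
    grind

theorem det_blockDiag3 {F : Type*} [Field F]
    (g : Fin 3 → Matrix (Fin 2 × Fin 2) (Fin 2 × Fin 2) F) :
    (blockDiag3 g).det = ∏ i, (g i).det := by
  rw [← det_blockDiagonal, ← det_submatrix_equiv_self (Equiv.prodComm (Fin 3) (Fin 2 × Fin 2))]
  rfl

theorem mul_blockDiag3 {F : Type*} [Field F] (M : Matrix Idx3 Idx3 F)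
    (g : Fin 3 → Matrix (Fin 2 × Fin 2) (Fin 2 × Fin 2) F) (u v : Idx3) :
    (M * blockDiag3 g) u v = (M *ᵥ fun w => if w.1 = v.1 then g w.1 w.2 v.2 else 0) u :=
  rfl

theorem stmt_8 (F : Type*) [Field F] [CharP F 2] (A : Matrix (Fin 3) (Fin 3) F)
    (h : A 0 1 * A 1 2 * A 2 0 ≠ A 0 2 * A 2 1 * A 1 0) :
    ∃ g : Fin 3 → Matrix (Fin 2 × Fin 2) (Fin 2 × Fin 2) F,
      (∀ i, IsUnit (g i).det) ∧
      (blockDiag3 g)⁻¹ * cubeBlock A * blockDiag3 g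
        = Matrix.of fun u v : Idx3 =>
            -- direct sum over the 4 summands indexed by `u.2`: the summand
            -- `(0,0)` is the transpose-Frobenius matrix `(a_{ji}²)`, the
            -- other three summands are the Frobenius matrix `(a_{ij}²)`
            if u.2 = v.2 then
              (if u.2 = ((0 : Fin 2), (0 : Fin 2)) then (A v.1 u.1) ^ 2
               else (A u.1 v.1) ^ 2)
            else 0 := by
  set g : Fin 3 → Matrix (Fin 2 × Fin 2) (Fin 2 × Fin 2) F :=
    fun i => of fun p s => summandVec A s.1 s.2 i p.1 p.2 with hg
  have hdet (i : Fin 3) : IsUnit (g i).det := by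
    rw [hg, det_of_summandVec]
    exact (pow_ne_zero 2 (sub_ne_zero.2 h)).isUnit
  have hunit : IsUnit (blockDiag3 g).det := by
    rw [det_blockDiag3]
    exact (Finset.prod_ne_zero_iff.2 fun i _ => (hdet i).ne_zero).isUnit
  refine ⟨g, hdet, ?_⟩
  have hcomm : cubeBlock A * blockDiag3 g = blockDiag3 g * of fun u v : Idx3 =>
      if u.2 = v.2 then summandMatrix A u.2 u.1 v.1 else 0 := by
    ext u ⟨j, s⟩
    have hcol : (fun w : Idx3 => if w.1 = j then g w.1 w.2 s else 0) =
        thickVec fun i => (Pi.single j 1 : Fin 3 → F) i • summandVec A s.1 s.2 i := by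
      funext w
      by_cases hw : w.1 = j <;> simp [thickVec, hg, hw]
    rw [mul_blockDiag3, hcol, cubeBlock_mulVec_summandVec]
    simp [thickVec, mul_apply, blockDiag3, Fintype.sum_prod_type, hg, mul_comm]
  rw [Matrix.mul_assoc, hcomm, nonsing_inv_mul_cancel_left _ _ hunit]
  rfl
end
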